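/- arXiv:1710.04093 — 3 statements merged into one kernel-verified Lean document; each statement's English description precedes it below -/
import Mathlib

section
/- Let p̄ ≥ 1 be a natural number, θ ∈ ℝ, ρ(θ) = e^θ/(1+e^θ), and let S be a Binomial(p̄, ρ(θ)) random variable. Then lim_{h→+∞} e^{−2hp̄} · Var(e^{hS}) = ρ(θ)^{p̄}(1 − ρ(θ)^{p̄}). Equivalently, the variance vₙ(h) of the n-sample importance-sampling estimator satisfies n·vₙ(h) ∼ e^{2hp̄}·ν(θ) as h → +∞, where ν(θ) = ρ(θ)^{p̄}(1 − ρ(θ)^{p̄}). -/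
open MeasureTheory ProbabilityTheory Real Filter

/-- If `S` is a Binomial(p̄, ρ(θ)) random variable with
`ρ(θ) = e^θ/(1+e^θ)`, then `lim_{h→+∞} e^{−2hp̄} Var(e^{hS}) = ρ(θ)^p̄ (1 − ρ(θ)^p̄)`;
equivalently, the variance `vₙ(h)` of the n-sample importance-sampling estimator
(which equals `(1/n) Var(e^{hS})`) satisfies `n vₙ(h) ∼ e^{2hp̄} ν(θ)` as `h → +∞`,
where `ν(θ) = ρ(θ)^p̄ (1 − ρ(θ)^p̄)`. -/
theorem variance_exp_binomial_asymptotics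
    {Ω : Type*} [MeasurableSpace Ω] (μ : Measure Ω) [IsProbabilityMeasure μ]
    (pbar : ℕ) (hpbar : 1 ≤ pbar) (θ : ℝ)
    (ρ : ℝ) (hρ : ρ = exp θ / (1 + exp θ))
    (S : Ω → ℕ) (hSmeas : Measurable S)
    (hlaw : ∀ k : ℕ,
      (μ (S ⁻¹' {k})).toReal = (pbar.choose k : ℝ) * ρ ^ k * (1 - ρ) ^ (pbar - k))
    (n : ℕ) (hn : 1 ≤ n)
    (v : ℕ → ℝ → ℝ)
    (hv : ∀ h : ℝ, v n h = (1 / (n : ℝ)) * variance (fun ω => exp (h * (S ω : ℝ))) μ) :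
    Tendsto (fun h : ℝ => exp (-(2 * h * pbar)) * variance (fun ω => exp (h * (S ω : ℝ))) μ)
        atTop (nhds (ρ ^ pbar * (1 - ρ ^ pbar))) ∧
      Tendsto (fun h : ℝ => (n : ℝ) * v n h / (exp (2 * h * pbar) * (ρ ^ pbar * (1 - ρ ^ pbar))))
        atTop (nhds 1) := by
  have hpos : 0 < exp θ := exp_pos θ
  have hρ0 : 0 < ρ := by rw [hρ]; positivity
  have hρ1 : ρ < 1 := by rw [hρ, div_lt_one (by positivity)]; linarith
  have hae : ∀ᵐ ω ∂μ, S ω ≤ pbar := by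
    have h1 : ∀ k : ℕ, pbar < k → ∀ᵐ ω ∂μ, S ω ≠ k := by
      intro k hk
      have h2 := hlaw k
      rw [Nat.choose_eq_zero_of_lt hk] at h2
      simp only [Nat.cast_zero, zero_mul] at h2
      have h3 : μ (S ⁻¹' {k}) = 0 := by
        rcases (ENNReal.toReal_eq_zero_iff _).1 h2 with h | h
        · exact h
        · exact absurd h (measure_ne_top _ _)
      rw [ae_iff]
      convert h3 using 2
      ext ω
      simp
    have h4 : ∀ᵐ ω ∂μ, ∀ k : ℕ, pbar < k → S ω ≠ k := by
      rw [ae_all_iff]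
      intro k
      by_cases hk : pbar < k
      · filter_upwards [h1 k hk] with ω hω _ using hω
      · exact Eventually.of_forall fun ω h => absurd h hk
    filter_upwards [h4] with ω hω
    by_contra hc
    exact hω (S ω) (not_le.1 hc) rfl
  have hmR : Measurable (fun ω => (S ω : ℝ)) := measurable_from_top.comp hSmeas
  have hmeas : ∀ h : ℝ, Measurable (fun ω => exp (h * ((S ω : ℝ) - pbar))) := fun h =>
    ((hmR.sub_const _).const_mul h).exp
  have hbd : ∀ h : ℝ, 0 ≤ h → ∀ᵐ ω ∂μ, ‖exp (h * ((S ω : ℝ) - pbar))‖ ≤ 1 := by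
    intro h hh
    filter_upwards [hae] with ω hω
    rw [Real.norm_eq_abs, abs_of_pos (exp_pos _), exp_le_one_iff]
    have : (S ω : ℝ) ≤ pbar := by exact_mod_cast hω
    exact mul_nonpos_of_nonneg_of_nonpos hh (by linarith)
  have hlim : Tendsto (fun h : ℝ => ∫ ω, exp (h * ((S ω : ℝ) - pbar)) ∂μ) atTop
      (nhds (ρ ^ pbar)) := by
    have hE : ∫ ω, (S ⁻¹' {pbar}).indicator (fun _ => (1 : ℝ)) ω ∂μ = ρ ^ pbar := by
      rw [integral_indicator_const _ (hSmeas (measurableSet_singleton _))]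
      have := hlaw pbar
      simp at this
      simp [Measure.real, this]
    rw [← hE]
    refine tendsto_integral_filter_of_dominated_convergence (fun _ => (1 : ℝ)) ?_ ?_ ?_ ?_
    · exact Eventually.of_forall fun h => (hmeas h).aestronglyMeasurable
    · filter_upwards [eventually_ge_atTop (0 : ℝ)] with h hh using hbd h hh
    · exact integrable_const _
    · filter_upwards [hae] with ω hω
      by_cases hk : S ω = pbar
      · simp [Set.indicator, hk]
      · have hlt : (S ω : ℝ) - pbar < 0 := by
          have : (S ω : ℝ) < pbar := by exact_mod_cast lt_of_le_of_ne hω hk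
          linarith
        simp only [Set.indicator, Set.mem_preimage, Set.mem_singleton_iff, hk, if_false]
        exact tendsto_exp_atBot.comp (tendsto_id.atTop_mul_const_of_neg hlt)
  have hlim2 : Tendsto (fun h : ℝ => ∫ ω, exp ((2 * h) * ((S ω : ℝ) - pbar)) ∂μ) atTop
      (nhds (ρ ^ pbar)) :=
    hlim.comp (tendsto_id.const_mul_atTop (by norm_num : (0 : ℝ) < 2))
  have main : Tendsto (fun h : ℝ => exp (-(2 * h * pbar)) *
      variance (fun ω => exp (h * (S ω : ℝ))) μ) atTop (nhds (ρ ^ pbar * (1 - ρ ^ pbar))) := by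
    have h1 := hlim2.sub (hlim.pow 2)
    have h2 : ρ ^ pbar - (ρ ^ pbar) ^ 2 = ρ ^ pbar * (1 - ρ ^ pbar) := by ring
    rw [h2] at h1
    refine h1.congr' ?_
    filter_upwards [eventually_ge_atTop (0 : ℝ)] with h hh
    have hL : MemLp (fun ω => exp (h * ((S ω : ℝ) - pbar))) 2 μ :=
      MemLp.of_bound (hmeas h).aestronglyMeasurable 1 (hbd h hh)
    have h3 := variance_eq_sub hL
    have h4 : (fun ω => exp (h * ((S ω : ℝ) - pbar))) =
        fun ω => exp (-(h * pbar)) * exp (h * (S ω : ℝ)) := by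
      funext ω
      rw [← Real.exp_add]
      congr 1
      ring
    have h5 : variance (fun ω => exp (h * ((S ω : ℝ) - pbar))) μ =
        exp (-(2 * h * pbar)) * variance (fun ω => exp (h * (S ω : ℝ))) μ := by
      rw [h4, variance_const_mul, ← Real.exp_nat_mul]
      congr 2
      push_cast
      ring
    rw [← h5, h3]
    congr 1
    refine integral_congr_ae (Eventually.of_forall fun ω => ?_)
    simp only [Pi.pow_apply]
    rw [← Real.exp_nat_mul]
    congr 1
    push_cast
    ring
  refine ⟨main, ?_⟩
  have hc : ρ ^ pbar * (1 - ρ ^ pbar) ≠ 0 := by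
    have h1 : ρ ^ pbar < 1 := pow_lt_one₀ hρ0.le hρ1 (by omega)
    have h2 : 0 < ρ ^ pbar := pow_pos hρ0 _
    exact (mul_pos h2 (by linarith)).ne'
  have h1 := main.div_const (ρ ^ pbar * (1 - ρ ^ pbar))
  rw [div_self hc] at h1
  refine h1.congr fun h => ?_
  have hn0 : (n : ℝ) ≠ 0 := by
    have : 0 < n := hn
    exact_mod_cast this.ne'
  rw [hv h, ← mul_assoc, mul_one_div_cancel hn0, one_mul, Real.exp_neg,
    ← div_div _ (exp (2 * h * pbar)) (ρ ^ pbar * (1 - ρ ^ pbar))]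
  congr 1
  rw [div_eq_mul_inv, mul_comm]
end

section
/- Let Ψ and Φ be real random variables on a common probability space with Ψ ≥ 0 almost surely, Φ > 0 almost surely, Φ integrable with E[Φ] > 0, and Ψ², (1/Φ)² and (Ψ/Φ)² integrable. Then E|Ψ/Φ − E[Ψ]/E[Φ]| ≤ √(Var(Ψ/Φ)) + √(Var(Ψ)·Var(1/Φ)) + E[Ψ]·(E[1/Φ] − 1/E[Φ]), where the last factor E[1/Φ] − 1/E[Φ] is nonnegative by Jensen's inequality. -/
open MeasureTheory ProbabilityTheory

lemma aux_cov_sq_le {Ω : Type*} [MeasurableSpace Ω] (μ : Measure Ω) [IsProbabilityMeasure μ]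
    (X Y : Ω → ℝ) (hX : MemLp X 2 μ) (hY : MemLp Y 2 μ) :
    |covariance X Y μ| ≤ Real.sqrt (variance X μ * variance Y μ) := by
  have h : ∀ t : ℝ, 0 ≤ variance Y μ * (t * t) + (2 * covariance X Y μ) * t + variance X μ := by
    intro t
    have h1 := variance_nonneg (X + t • Y) μ
    rw [variance_add hX (hY.const_smul t), variance_smul, covariance_smul_right] at h1
    nlinarith
  have h2 := discrim_le_zero h
  unfold discrim at h2
  apply Real.abs_le_sqrt
  nlinarith

/-- For `Ψ ≥ 0` a.s. and `Φ > 0` a.s. with `E[Φ] > 0` and the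
relevant squares integrable, the mean absolute deviation of the ratio estimator
`Ψ/Φ` from `E[Ψ]/E[Φ]` satisfies
`E|Ψ/Φ − E[Ψ]/E[Φ]| ≤ √Var(Ψ/Φ) + √(Var(Ψ)·Var(1/Φ)) + E[Ψ](E[1/Φ] − 1/E[Φ])`. -/
theorem abs_deviation_ratio_estimator_le
    {Ω : Type*} [MeasurableSpace Ω] (μ : Measure Ω) [IsProbabilityMeasure μ]
    (Ψ Φ : Ω → ℝ) (hΨmeas : Measurable Ψ) (hΦmeas : Measurable Φ)
    (hΨpos : ∀ᵐ ω ∂μ, 0 ≤ Ψ ω) (hΦpos : ∀ᵐ ω ∂μ, 0 < Φ ω)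
    (hΦint : Integrable Φ μ) (hEΦ : 0 < ∫ ω, Φ ω ∂μ)
    (hΨ2 : Integrable (fun ω => (Ψ ω) ^ 2) μ)
    (hinvΦ2 : Integrable (fun ω => (1 / Φ ω) ^ 2) μ)
    (hratio2 : Integrable (fun ω => (Ψ ω / Φ ω) ^ 2) μ) :
    ∫ ω, |Ψ ω / Φ ω - (∫ ω', Ψ ω' ∂μ) / ∫ ω', Φ ω' ∂μ| ∂μ
      ≤ Real.sqrt (variance (fun ω => Ψ ω / Φ ω) μ)
        + Real.sqrt (variance Ψ μ * variance (fun ω => 1 / Φ ω) μ)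
        + (∫ ω, Ψ ω ∂μ) * ((∫ ω, 1 / Φ ω ∂μ) - 1 / ∫ ω, Φ ω ∂μ) := by

  have mΨ : MemLp Ψ 2 μ := (memLp_two_iff_integrable_sq hΨmeas.aestronglyMeasurable).2 hΨ2
  have mI : MemLp (fun ω => 1 / Φ ω) 2 μ :=
    (memLp_two_iff_integrable_sq (hΦmeas.const_div 1).aestronglyMeasurable).2 hinvΦ2
  have mR : MemLp (fun ω => Ψ ω / Φ ω) 2 μ :=
    (memLp_two_iff_integrable_sq (hΨmeas.div hΦmeas).aestronglyMeasurable).2 hratio2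
  have iI := mI.integrable one_le_two
  have iR := mR.integrable one_le_two
  have hcov := aux_cov_sq_le μ Ψ (fun ω => 1 / Φ ω) mΨ mI
  rw [covariance_eq_sub mΨ mI] at hcov
  have hprod : ∫ ω, (Ψ * fun ω => 1 / Φ ω) ω ∂μ = ∫ ω, Ψ ω / Φ ω ∂μ := by
    congr 1; ext ω; simp [div_eq_mul_inv]
  rw [hprod] at hcov
  have hEΨ : 0 ≤ ∫ ω, Ψ ω ∂μ := integral_nonneg_of_ae hΨpos
  set m := ∫ ω, Φ ω ∂μ with hm
  set p := ∫ ω, Ψ ω ∂μ with hp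
  set r := ∫ ω, Ψ ω / Φ ω ∂μ with hr
  set q := ∫ ω, 1 / Φ ω ∂μ with hq
  have hJ : 1 / m ≤ q := by
    have h1 : ∫ ω, (2 / m - Φ ω / m ^ 2) ∂μ ≤ q := by
      apply integral_mono_ae ((integrable_const _).sub (hΦint.div_const _)) iI
      filter_upwards [hΦpos] with ω h
      have : 1 / Φ ω - (2 / m - Φ ω / m ^ 2) = (m - Φ ω) ^ 2 / (Φ ω * m ^ 2) := by
        field_simp
        ring
      have h2 : 0 ≤ (m - Φ ω) ^ 2 / (Φ ω * m ^ 2) := by positivity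
      show 2 / m - Φ ω / m ^ 2 ≤ 1 / Φ ω
      linarith
    rw [integral_sub (integrable_const _) (hΦint.div_const _), integral_div, integral_div, ← hm] at h1
    have h3 : 2 / m - m / m ^ 2 = 1 / m := by field_simp; ring
    simp only [integral_const, probReal_univ, one_smul] at h1
    rw [h3] at h1
    exact h1
  have mD : MemLp (fun ω => |Ψ ω / Φ ω - r|) 2 μ := (mR.sub (memLp_const r)).abs
  have hdev : ∫ ω, |Ψ ω / Φ ω - r| ∂μ ≤ Real.sqrt (variance (fun ω => Ψ ω / Φ ω) μ) := by
    apply Real.le_sqrt_of_sq_le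
    have h1 := variance_nonneg (fun ω => |Ψ ω / Φ ω - r|) μ
    rw [variance_eq_sub mD] at h1
    rw [variance_eq_integral mR.aestronglyMeasurable.aemeasurable]
    simpa using h1
  have htri : ∫ ω, |Ψ ω / Φ ω - p / m| ∂μ ≤ ∫ ω, (|Ψ ω / Φ ω - r| + |r - p / m|) ∂μ := by
    apply integral_mono (iR.sub (integrable_const _)).abs
      ((mD.integrable one_le_two).add (integrable_const _))
    intro ω
    exact abs_sub_le _ _ _
  rw [integral_add (mD.integrable one_le_two) (integrable_const _)] at htri
  simp only [integral_const, probReal_univ, one_smul] at htri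
  have h5 : |r - p / m| ≤ |r - p * q| + p * (q - 1 / m) := by
    have h6 := abs_sub_le r (p * q) (p / m)
    have h7 : p * q - p / m = p * (q - 1 / m) := by ring
    rwa [h7, abs_of_nonneg (mul_nonneg hEΨ (sub_nonneg.2 hJ))] at h6
  linarith
end

section
/- Let (Θ, 𝒜) be a measurable space, let h be a Markov kernel from Θ to Θ, and let α, α̂ : Θ × Θ → [0,1] be jointly measurable. Define the Metropolis–Hastings-type kernels P(θ, A) = ∫_A α(θ,θ') h(θ, dθ') + δ_θ(A)·(1 − ∫_Θ α(θ,θ') h(θ, dθ')) and P̂(θ, A) = ∫_A α̂(θ,θ') h(θ, dθ') + δ_θ(A)·(1 − ∫_Θ α̂(θ,θ') h(θ, dθ')). Then for every θ ∈ Θ, the total variation distance ‖P(θ,·) − P̂(θ,·)‖ := sup_{A∈𝒜} |P(θ,A) − P̂(θ,A)| satisfies ‖P(θ,·) − P̂(θ,·)‖ ≤ ∫_Θ |α(θ,θ') − α̂(θ,θ')| h(θ, dθ'). -/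
open MeasureTheory ProbabilityTheory Classical
open scoped Classical

/-- For a Markov proposal kernel `h` and jointly measurable
acceptance probabilities `α, α̂ : Θ × Θ → [0,1]`, the Metropolis–Hastings-type
kernels `P(θ,A) = ∫_A α(θ,·) dh(θ,·) + δ_θ(A)(1 − ∫ α(θ,·) dh(θ,·))` and the
corresponding `P̂` built from `α̂` satisfy, for every `θ`, the total-variation
bound `sup_A |P(θ,A) − P̂(θ,A)| ≤ ∫ |α(θ,θ') − α̂(θ,θ')| dh(θ,dθ')`, stated here
as the bound for every measurable set `A`. -/
theorem tv_dist_noisy_MH_kernel_le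
    {Θ : Type*} [MeasurableSpace Θ]
    (h : Kernel Θ Θ) [IsMarkovKernel h]
    (α αhat : Θ → Θ → ℝ)
    (hαmeas : Measurable (fun p : Θ × Θ => α p.1 p.2))
    (hαhatmeas : Measurable (fun p : Θ × Θ => αhat p.1 p.2))
    (hα01 : ∀ θ θ', α θ θ' ∈ Set.Icc (0 : ℝ) 1)
    (hαhat01 : ∀ θ θ', αhat θ θ' ∈ Set.Icc (0 : ℝ) 1)
    (P Phat : Θ → Set Θ → ℝ)
    (hP : ∀ θ A, P θ A = (∫ θ' in A, α θ θ' ∂(h θ))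
      + (A.indicator (fun _ => (1:ℝ)) θ) * (1 - ∫ θ', α θ θ' ∂(h θ)))
    (hPhat : ∀ θ A, Phat θ A = (∫ θ' in A, αhat θ θ' ∂(h θ))
      + (A.indicator (fun _ => (1:ℝ)) θ) * (1 - ∫ θ', αhat θ θ' ∂(h θ))) :
    ∀ θ : Θ, ∀ A : Set Θ, MeasurableSet A →
      |P θ A - Phat θ A| ≤ ∫ θ', |α θ θ' - αhat θ θ'| ∂(h θ) := by
  intro θ A hA
  have key : ∀ f : Θ → Θ → ℝ, Measurable (fun p : Θ × Θ => f p.1 p.2) →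
      (∀ θ θ', f θ θ' ∈ Set.Icc (0 : ℝ) 1) → Integrable (f θ) (h θ) := by
    intro f hf h01
    have hm : Measurable (f θ) := hf.comp (measurable_const.prodMk measurable_id)
    refine Integrable.of_bound hm.aestronglyMeasurable 1 (ae_of_all _ fun x => ?_)
    rw [Real.norm_eq_abs, abs_of_nonneg (h01 θ x).1]
    exact (h01 θ x).2
  have h1 := key α hαmeas hα01
  have h2 := key αhat hαhatmeas hαhat01
  have bound : ∀ B : Set Θ, |(∫ θ' in B, α θ θ' ∂(h θ)) - ∫ θ' in B, αhat θ θ' ∂(h θ)|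
      ≤ ∫ θ', |α θ θ' - αhat θ θ'| ∂(h θ) := by
    intro B
    rw [← integral_sub h1.integrableOn h2.integrableOn]
    exact abs_integral_le_integral_abs.trans
      (setIntegral_le_integral (h1.sub h2).abs (ae_of_all _ fun x => abs_nonneg _))
  rw [hP, hPhat]
  by_cases hθ : θ ∈ A
  · have e1 := integral_add_compl hA h1
    have e2 := integral_add_compl hA h2
    have hb := bound Aᶜ
    rw [abs_sub_comm] at hb
    rw [Set.indicator_of_mem hθ, ← e1, ← e2]
    convert hb using 2
    ring
  · rw [Set.indicator_of_notMem hθ]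
    simpa using bound A
end
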